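/- Let φ(u) be the conjunction of the first-order formulas: R₃(u,u); ∀v(R₃(u,v)→∃w(R₃(v,w)∧R₂(w,v))); ∀v∀w(R₃(u,v)∧R₃(v,w)→R₃(u,w)); ¬∃v R₂(u,v); and ∀v∀w(R₃(u,v) ∧ ∃^{≥2}s(R₂(v,s)∧R₃(u,s)) ∧ R₁(u,w) → R₄(w,v)). Let ψ(x) := ∃u(R₁(u,x)∧φ(u)) and χ := ∀x(∃y R₄(x,y) → ψ(x)). Then the sentence χ is preserved under taking generated subframes within the class of finite frames: for all finite frames F,G over the signature {R₁,R₂,R₃,R₄} with F a generated subframe of G, if G ⊨ χ then F ⊨ χ. -/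

import Mathlib

/-- A frame: a first-order structure over a signature consisting of
binary relation symbols indexed by `I`. -/
structure KFrame (I : Type) where
  W : Type
  R : I → W → W → Prop

/-- First-order formulas over a signature of binary relation symbols indexed
by `I`, with variables indexed by `ℕ`. -/
inductive FO (I : Type) : Type
  | eq : ℕ → ℕ → FO I
  | rel : I → ℕ → ℕ → FO I
  | fal : FO I
  | neg : FO I → FO I
  | and : FO I → FO I → FO I
  | or : FO I → FO I → FO I
  | imp : FO I → FO I → FO I
  | ex : ℕ → FO I → FO I
  | all : ℕ → FO I → FO I

/-- Tarskian satisfaction of a first-order formula in a frame, relative to a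
variable assignment `g`. -/
def FOSat {I : Type} (F : KFrame I) : (ℕ → F.W) → FO I → Prop
  | g, .eq x y => g x = g y
  | g, .rel i x y => F.R i (g x) (g y)
  | _, .fal => False
  | g, .neg φ => ¬ FOSat F g φ
  | g, .and φ ψ => FOSat F g φ ∧ FOSat F g ψ
  | g, .or φ ψ => FOSat F g φ ∨ FOSat F g ψ
  | g, .imp φ ψ => FOSat F g φ → FOSat F g ψ
  | g, .ex x φ => ∃ d : F.W, FOSat F (Function.update g x d) φ
  | g, .all x φ => ∀ d : F.W, FOSat F (Function.update g x d) φ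

/-- The free variables of a first-order formula. -/
def freeVars {I : Type} : FO I → Finset ℕ
  | .eq x y => {x, y}
  | .rel _ x y => {x, y}
  | .fal => ∅
  | .neg φ => freeVars φ
  | .and φ ψ => freeVars φ ∪ freeVars ψ
  | .or φ ψ => freeVars φ ∪ freeVars ψ
  | .imp φ ψ => freeVars φ ∪ freeVars ψ
  | .ex x φ => freeVars φ \ {x}
  | .all x φ => freeVars φ \ {x}

/-- Truth of a (closed) first-order formula in a frame. -/
def FrameSat {I : Type} (F : KFrame I) (φ : FO I) : Prop :=
  ∀ g : ℕ → F.W, FOSat F g φ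

/-- `X` is closed under the relations of `G` (i.e. the restriction of `G` to
`X` is a generated subframe of `G`). -/
def RClosed {I : Type} (G : KFrame I) (X : Set G.W) : Prop :=
  ∀ (i : I) (w v : G.W), w ∈ X → G.R i w v → v ∈ X

/-- The restriction of a frame to a subset of its domain. -/
def KFrame.restrict {I : Type} (G : KFrame I) (X : Set G.W) : KFrame I :=
  ⟨X, fun i u v => G.R i u.1 v.1⟩

/- Relation indices in `Fin 4`: `R₁ = 0`, `R₂ = 1`, `R₃ = 2`, `R₄ = 3`.
   Variable indices: `u = 0`, `v = 1`, `w = 2`, `s = 3`, `s' = 4`, `x = 5`, `y = 6`. -/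

/-- `∃^{≥2} s (R₂(v,s) ∧ R₃(u,s))` with `u = 0`, `v = 1`, witnesses `s = 3, s' = 4`. -/
def geqTwo : FO (Fin 4) :=
  .ex 3 (.ex 4 (.and (.neg (.eq 3 4))
    (.and (.and (.rel 1 1 3) (.rel 2 0 3))
          (.and (.rel 1 1 4) (.rel 2 0 4)))))

/-- The formula `φ(u)` (with `u = 0`): the conjunction of
`R₃(u,u)`; `∀v(R₃(u,v) → ∃w(R₃(v,w) ∧ R₂(w,v)))`;
`∀v∀w(R₃(u,v) ∧ R₃(v,w) → R₃(u,w))`; `¬∃v R₂(u,v)`; and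
`∀v∀w(R₃(u,v) ∧ ∃^{≥2}s(R₂(v,s) ∧ R₃(u,s)) ∧ R₁(u,w) → R₄(w,v))`. -/
def phiU : FO (Fin 4) :=
  .and (.rel 2 0 0)
  (.and (.all 1 (.imp (.rel 2 0 1) (.ex 2 (.and (.rel 2 1 2) (.rel 1 2 1)))))
  (.and (.all 1 (.all 2 (.imp (.and (.rel 2 0 1) (.rel 2 1 2)) (.rel 2 0 2))))
  (.and (.neg (.ex 1 (.rel 1 0 1)))
        (.all 1 (.all 2 (.imp (.and (.rel 2 0 1) (.and geqTwo (.rel 0 0 2)))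
                              (.rel 3 2 1)))))))

/-- `ψ(x) = ∃u(R₁(u,x) ∧ φ(u))`, with `x = 5`. -/
def psiX : FO (Fin 4) := .ex 0 (.and (.rel 0 0 5) phiU)

/-- `χ = ∀x(∃y R₄(x,y) → ψ(x))`. -/
def chi : FO (Fin 4) := .all 5 (.imp (.ex 6 (.rel 3 5 6)) psiX)

/-- On a finite set `B` containing a point `u` without `r`-successors, a relation `r` that
relates to every point of `B` some point of `B` has a point of `B` with two `r`-successors
in `B`. -/
theorem exists_two_successors {α : Type*} [Finite α] {r : α → α → Prop} {B : Set α} {u : α}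
    (hu : u ∈ B) (hr : ∀ v ∈ B, ∃ w ∈ B, r w v) (hmin : ∀ v, ¬ r u v) :
    ∃ v ∈ B, ∃ s ∈ B, ∃ t ∈ B, s ≠ t ∧ r v s ∧ r v t := by
  choose f hfB hf using hr
  let F : B → B := fun v => ⟨f v v.2, hfB v v.2⟩
  have hF : ¬ Function.Injective F := fun hinj => by
    obtain ⟨v, hv⟩ := Finite.surjective_of_injective hinj ⟨u, hu⟩
    have huv : f v v.2 = u := congrArg Subtype.val hv
    exact hmin v (huv ▸ hf v v.2)
  simp only [Function.Injective, not_forall] at hF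
  obtain ⟨s, t, hst, hne⟩ := hF
  have hval : f s s.2 = f t t.2 := congrArg Subtype.val hst
  exact ⟨f s s.2, hfB s s.2, s, s.2, t, t.2, fun h => hne (Subtype.ext h), hf s s.2,
    hval ▸ hf t t.2⟩

/-- The semantic content of `phiU` at a point `u`. -/
structure PhiAt (G : KFrame (Fin 4)) (u : G.W) : Prop where
  refl : G.R 2 u u
  succ : ∀ v, G.R 2 u v → ∃ w, G.R 2 v w ∧ G.R 1 w v
  trans : ∀ v w, G.R 2 u v → G.R 2 v w → G.R 2 u w
  minimal : ∀ v, ¬ G.R 1 u v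
  branch : ∀ v w s t, G.R 2 u v → s ≠ t → G.R 1 v s → G.R 2 u s → G.R 1 v t → G.R 2 u t →
    G.R 0 u w → G.R 3 w v

theorem foSat_phiU_iff {G : KFrame (Fin 4)} (g : ℕ → G.W) :
    FOSat G g phiU ↔ PhiAt G (g 0) := by
  simp only [phiU, geqTwo, FOSat, Function.update_apply]
  norm_num
  constructor
  · rintro ⟨h₁, h₂, h₃, h₄, h₅⟩
    exact ⟨h₁, h₂, h₃, h₄, fun v w s t hv hst hs hus ht hut hw =>
      h₅ v w hv s t hst hs hus ht hut hw⟩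
  · rintro ⟨h₁, h₂, h₃, h₄, h₅⟩
    exact ⟨h₁, h₂, h₃, h₄, fun v w hv s t hst hs hus ht hut hw =>
      h₅ v w s t hv hst hs hus ht hut hw⟩

theorem frameSat_chi_iff {G : KFrame (Fin 4)} :
    FrameSat G chi ↔ ∀ x y, G.R 3 x y → ∃ u, G.R 0 u x ∧ PhiAt G u := by
  simp only [FrameSat, chi, psiX, FOSat, foSat_phiU_iff, Function.update_apply]
  norm_num
  exact ⟨fun h x y hxy => h (fun _ => x) x y hxy, fun h _ x y hxy => h x y hxy⟩

/-- In a finite frame, a closed set containing an `R₁`-successor of a point satisfying `phiU`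
contains that point. -/
theorem PhiAt.mem_of_succ_mem {G : KFrame (Fin 4)} [Finite G.W] {X : Set G.W}
    (hX : RClosed G X) {u x : G.W} (hu : PhiAt G u) (hux : G.R 0 u x) (hx : x ∈ X) : u ∈ X := by
  obtain ⟨v, hv, s, hs, t, ht, hst, hvs, hvt⟩ :=
    exists_two_successors (r := G.R 1) (B := {v | G.R 2 u v ∧ (v ∈ X → u ∈ X)}) (u := u)
      ⟨hu.refl, id⟩
      (fun v hv => by
        obtain ⟨w, hvw, hwv⟩ := hu.succ v hv.1
        exact ⟨w, ⟨hu.trans v w hv.1 hvw, fun hw => hv.2 (hX 1 w v hw hwv)⟩, hwv⟩)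
      hu.minimal
  exact hv.2 (hX 3 x v hx (hu.branch v x s t hv.1 hst hvs hs.1 hvt ht.1 hux))

/-- `phiU` is inherited by generated subframes. -/
theorem PhiAt.restrict {G : KFrame (Fin 4)} {X : Set G.W} (hX : RClosed G X) {u : G.W}
    (hu : PhiAt G u) (huX : u ∈ X) : PhiAt (G.restrict X) ⟨u, huX⟩ where
  refl := hu.refl
  succ v huv := by
    obtain ⟨w, hvw, hwv⟩ := hu.succ v.1 huv
    exact ⟨⟨w, hX 2 v.1 w v.2 hvw⟩, hvw, hwv⟩
  trans v w := hu.trans v.1 w.1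
  minimal v := hu.minimal v.1
  branch v w s t huv hst := hu.branch v.1 w.1 s.1 t.1 huv (fun h => hst (Subtype.ext h))

/-- Lemma 3.5: the sentence `χ` is preserved under taking generated subframes
within the class of finite frames. -/
theorem chi_preserved_generated_subframes_finite :
    ∀ (G : KFrame (Fin 4)), Finite G.W → ∀ X : Set G.W, RClosed G X →
      FrameSat G chi → FrameSat (G.restrict X) chi := by
  intro G _ X hX hG
  rw [frameSat_chi_iff] at hG ⊢
  intro x y hxy
  obtain ⟨u, hux, hu⟩ := hG x.1 y.1 hxy
  have huX := hu.mem_of_succ_mem hX hux x.2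
  exact ⟨⟨u, huX⟩, hux, hu.restrict hX huX⟩
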